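/- arXiv:1606.00216 — 2 statements merged into one kernel-verified Lean document; each statement's English description precedes it below -/
import Mathlib

section
/- Let E = ⟨t,y | t^n, y^r t^A y^{-s} t^{-A}⟩ with n > 0 and r^{n/(n,A)} ≠ s^{n/(n,A)} (or r = s = 0). Then E is virtually free, i.e., E has a free subgroup of finite index. -/
/-- The relators of the group `E(r,n,s,A) = ⟨t,y | t^n, y^r t^A y^{-s} t^{-A}⟩`,
where `t` is indexed by `true` and `y` by `false`. -/
def Erels (n : ℕ) (r s A : ℤ) : Set (FreeGroup Bool) :=
  {FreeGroup.of true ^ (n : ℤ),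
   FreeGroup.of false ^ r * FreeGroup.of true ^ A *
     FreeGroup.of false ^ (-s) * FreeGroup.of true ^ (-A)}

theorem vf_core {G : Type} [Group G] {Q : Type} [Group Q] [Finite Q] (φ : G →* Q)
    (S : Set G) (hS : Subgroup.closure S = ⊤)
    (Φ : G →* Equiv.Perm (Q × FreeGroup G)) (h : Q → G)
    (hgen : ∀ g ∈ S, ∀ q, ∃ c : FreeGroup G, (∀ f, Φ g (q, f) = (φ g * q, c * f)) ∧
      h (φ g * q) * FreeGroup.lift id c = g * h q) :
    ∃ (F : Subgroup G) (ι : Type), F.FiniteIndex ∧ Nonempty (F ≃* FreeGroup ι) := by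
  have hall : ∀ g : G, ∀ q, ∃ c : FreeGroup G, (∀ f, Φ g (q, f) = (φ g * q, c * f)) ∧
      h (φ g * q) * FreeGroup.lift id c = g * h q := by
    intro g
    have hg : g ∈ Subgroup.closure S := by rw [hS]; trivial
    induction hg using Subgroup.closure_induction with
    | mem x hx => exact hgen x hx
    | one => intro q; exact ⟨1, by simp, by simp⟩
    | mul x y _ _ hx hy =>
      intro q
      obtain ⟨c, hc1, hc2⟩ := hy q
      obtain ⟨d, hd1, hd2⟩ := hx (φ y * q)
      refine ⟨d * c, ?_, ?_⟩
      · intro f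
        simp [hc1, hd1, mul_assoc]
      · rw [map_mul, map_mul, mul_assoc, mul_assoc x, ← hc2, ← mul_assoc, ← mul_assoc x, ← hd2]
    | inv x _ hx =>
      intro q
      obtain ⟨c, hc1, hc2⟩ := hx (φ x⁻¹ * q)
      have e : φ x * (φ x⁻¹ * q) = q := by simp
      rw [e] at hc1 hc2
      refine ⟨c⁻¹, ?_, ?_⟩
      · intro f
        rw [map_inv, Equiv.Perm.inv_eq_iff_eq, hc1]
        simp
      · rw [map_inv (FreeGroup.lift id) c, mul_inv_eq_iff_eq_mul, mul_assoc, hc2]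
        simp
  let c : φ.ker →* FreeGroup G :=
    { toFun := fun g => (Φ g (1, 1)).2
      map_one' := by simp
      map_mul' := by
        intro x y
        obtain ⟨c, hc1, _⟩ := hall y 1
        obtain ⟨d, hd1, _⟩ := hall x 1
        have hy : φ y = 1 := y.2
        rw [hy, one_mul] at hc1
        simp [hc1, hd1] }
  have hc : Function.Injective c := by
    rw [injective_iff_map_eq_one]
    intro g hg
    obtain ⟨d, hd1, hd2⟩ := hall g 1
    have hg' : φ g = 1 := g.2
    have : d = 1 := by
      have : (Φ g (1, 1)).2 = 1 := hg
      simpa [hd1] using this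
    rw [this, hg'] at hd2
    have : (g : G) = 1 := by simpa using hd2.symm
    exact Subtype.ext this
  have e := MonoidHom.ofInjective hc
  have : IsFreeGroup c.range := inferInstance
  refine ⟨φ.ker, IsFreeGroup.Generators c.range, inferInstance, ⟨e.trans (IsFreeGroup.toFreeGroup c.range)⟩⟩

theorem exists_equivariant {G Q : Type} [Group G] [Group Q] (φ : G →* Q) (K : Subgroup G)
    (hK : ∀ k ∈ K, φ k = 1 → k = 1) :
    ∃ h : Q → G, ∀ k ∈ K, ∀ q, h (φ k * q) = k * h q := by
  classical
  let rep : Q → Q := fun q => (Quotient.out (Quotient.mk (QuotientGroup.rightRel (K.map φ)) q))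
  have hrep : ∀ q, ∃ k ∈ K, φ k * rep q = q := by
    intro q
    have : (QuotientGroup.rightRel (K.map φ)) (rep q) q := Quotient.exact (Quotient.out_eq _)
    rw [QuotientGroup.rightRel_apply] at this
    obtain ⟨k, hk, hk'⟩ := this
    exact ⟨k, hk, by rw [hk']; simp⟩
  choose h hh1 hh2 using hrep
  refine ⟨h, fun k hk q => ?_⟩
  have hr : rep (φ k * q) = rep q := by
    refine congrArg Quotient.out (Quotient.sound ?_)
    show (QuotientGroup.rightRel (K.map φ)) _ _
    rw [QuotientGroup.rightRel_apply]
    exact ⟨k⁻¹, K.inv_mem hk, by simp⟩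
  have h1 : φ (h (φ k * q)) * rep q = φ k * (φ (h q) * rep q) := by
    rw [hh2 q, ← hr, hh2]
  rw [← mul_assoc, mul_left_inj, ← map_mul] at h1
  have := hK ((k * h q)⁻¹ * h (φ k * q)) (K.mul_mem (K.inv_mem (K.mul_mem hk (hh1 q))) (hh1 _))
    (by rw [map_mul, map_inv, h1]; simp)
  exact (inv_mul_eq_one.mp this).symm

theorem E_hom {n : ℕ} {r s A : ℤ} {X : Type} [Group X] (a b : X) (ha : a ^ n = 1)
    (hb : b ^ r * a ^ A = a ^ A * b ^ s) :
    ∃ f : PresentedGroup (Erels n r s A) →* X,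
      f (PresentedGroup.of true) = a ∧ f (PresentedGroup.of false) = b := by
  have hr : ∀ w ∈ Erels n r s A, FreeGroup.lift (fun i : Bool => if i then a else b) w = 1 := by
    intro w hw
    rcases hw with rfl | rfl
    · simp [ha]
    · simp [hb]
  refine ⟨PresentedGroup.toGroup hr, ?_, ?_⟩
  · rw [PresentedGroup.toGroup.of]; simp
  · rw [PresentedGroup.toGroup.of]; simp

theorem E_rel1 (n : ℕ) (r s A : ℤ) :
    (PresentedGroup.of true : PresentedGroup (Erels n r s A)) ^ n = 1 := by
  have := PresentedGroup.one_of_mem (rels := Erels n r s A)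
    (x := FreeGroup.of true ^ (n : ℤ)) (Or.inl rfl)
  rw [map_zpow, zpow_natCast] at this
  exact this

theorem E_rel2 (n : ℕ) (r s A : ℤ) :
    (PresentedGroup.of false : PresentedGroup (Erels n r s A)) ^ r * PresentedGroup.of true ^ A
     = PresentedGroup.of true ^ A * PresentedGroup.of false ^ s := by
  have := PresentedGroup.one_of_mem (rels := Erels n r s A) (Or.inr rfl)
  rw [map_mul, map_mul, map_mul, map_zpow, map_zpow, map_zpow, map_zpow, zpow_neg, zpow_neg,
    mul_inv_eq_one, mul_inv_eq_iff_eq_mul] at this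
  exact this

theorem E_gen (n : ℕ) (r s A : ℤ) :
    Subgroup.closure {(PresentedGroup.of true : PresentedGroup (Erels n r s A)),
      PresentedGroup.of false} = ⊤ := by
  rw [← PresentedGroup.closure_range_of]
  congr 1
  ext x
  simp [or_comm]

/-- The case `r = s = 0`. -/
theorem E_zero (n : ℕ) (hn : 0 < n) (A : ℤ) :
    ∃ (F : Subgroup (PresentedGroup (Erels n 0 0 A))) (ι : Type),
      F.FiniteIndex ∧ Nonempty (F ≃* FreeGroup ι) := by
  have : NeZero n := ⟨hn.ne'⟩
  set t : PresentedGroup (Erels n 0 0 A) := PresentedGroup.of true with ht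
  set y : PresentedGroup (Erels n 0 0 A) := PresentedGroup.of false with hy
  obtain ⟨φ, hφt, hφy⟩ := E_hom (n := n) (r := 0) (s := 0) (A := A)
    (Multiplicative.ofAdd (1 : ZMod n)) 1
    (by rw [← ofAdd_nsmul]; simp) (by simp)
  rw [← ht] at hφt
  rw [← hy] at hφy
  obtain ⟨h, hh⟩ := exists_equivariant φ (Subgroup.zpowers t) (by
    rintro k ⟨i, rfl⟩ hk
    simp only [map_zpow, hφt] at hk
    rw [← ofAdd_zsmul] at hk
    have hk : i • (1 : ZMod n) = 0 := hk
    rw [zsmul_one, ZMod.intCast_zmod_eq_zero_iff_dvd] at hk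
    obtain ⟨j, rfl⟩ := hk
    simp only []
    rw [zpow_mul, zpow_natCast, E_rel1, one_zpow])
  let F := FreeGroup (PresentedGroup (Erels n 0 0 A))
  let w : Multiplicative (ZMod n) → F := fun q => FreeGroup.of ((h q)⁻¹ * y * h q)
  let τ : Multiplicative (ZMod n) →* Equiv.Perm (Multiplicative (ZMod n) × F) :=
    { toFun := fun q => Equiv.prodCongr (Equiv.mulLeft q) (Equiv.refl _)
      map_one' := by ext <;> simp
      map_mul' := by intro a b; ext <;> simp [mul_assoc] }
  obtain ⟨Φ, hΦt, hΦy⟩ := E_hom (n := n) (r := 0) (s := 0) (A := A) (τ (φ t))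
    (Equiv.prodShear (Equiv.refl _) (fun q => Equiv.mulLeft (w q)))
    (by rw [← map_pow, ← map_pow, E_rel1, map_one, map_one]) (by simp)
  refine vf_core φ {t, y} (E_gen n 0 0 A) Φ h ?_
  rintro g (rfl | rfl) q
  · refine ⟨1, ?_, ?_⟩
    · intro f
      rw [hΦt]; simp [τ]
    · rw [hh _ (Subgroup.mem_zpowers t)]; simp
  · refine ⟨w q, ?_, ?_⟩
    · intro f
      rw [hΦy, hφy]; simp
    · rw [hφy]; simp [w, mul_assoc]

/-- The main geometric step. -/
theorem E_main (n : ℕ) (r s A g rr ss : ℤ) {Q : Type} [Group Q] [Finite Q]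
    (hr : r = g * rr) (hs : s = g * ss)
    (φ : PresentedGroup (Erels n r s A) →* Q)
    (K : Subgroup (PresentedGroup (Erels n r s A)))
    (hKt : PresentedGroup.of true ^ A ∈ K) (hKy : PresentedGroup.of false ^ g ∈ K)
    (hK : ∀ k ∈ K, φ k = 1 → k = 1)
    (hT : ∀ k ∈ Subgroup.zpowers (PresentedGroup.of true), φ k = 1 → k = 1)
    (hY : ∀ k ∈ Subgroup.zpowers (PresentedGroup.of false), φ k = 1 → k = 1) :
    ∃ (F : Subgroup (PresentedGroup (Erels n r s A))) (ι : Type),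
      F.FiniteIndex ∧ Nonempty (F ≃* FreeGroup ι) := by
  set t : PresentedGroup (Erels n r s A) := PresentedGroup.of true with ht
  set y : PresentedGroup (Erels n r s A) := PresentedGroup.of false with hy
  obtain ⟨h, hh⟩ := exists_equivariant φ K hK
  obtain ⟨α, hα⟩ := exists_equivariant φ _ hT
  obtain ⟨β, hβ⟩ := exists_equivariant φ _ hY
  let F := FreeGroup (PresentedGroup (Erels n r s A))
  let x : Q → F := fun q => FreeGroup.of ((α q)⁻¹ * h q)
  let w : Q → F := fun q => FreeGroup.of ((β q)⁻¹ * h q)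
  let τ : Q →* Equiv.Perm (Q × F) :=
    { toFun := fun q => Equiv.prodCongr (Equiv.mulLeft q) (Equiv.refl _)
      map_one' := by ext <;> simp
      map_mul' := by intro a b; ext <;> simp [mul_assoc] }
  let X : Equiv.Perm (Q × F) := Equiv.prodShear (Equiv.refl _) (fun q => Equiv.mulLeft (x q))
  let W : Equiv.Perm (Q × F) := Equiv.prodShear (Equiv.refl _) (fun q => Equiv.mulLeft (w q))
  have hX : ∀ q f, X (q, f) = (q, x q * f) := fun q f => rfl
  have hW : ∀ q f, W (q, f) = (q, w q * f) := fun q f => rfl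
  have hX' : ∀ q f, X⁻¹ (q, f) = (q, (x q)⁻¹ * f) := by
    intro q f; rw [Equiv.Perm.inv_eq_iff_eq, hX, mul_inv_cancel_left]
  have hW' : ∀ q f, W⁻¹ (q, f) = (q, (w q)⁻¹ * f) := by
    intro q f; rw [Equiv.Perm.inv_eq_iff_eq, hW, mul_inv_cancel_left]
  have hτ : ∀ a q f, τ a (q, f) = (a * q, f) := fun a q f => rfl
  have hcX : X * τ (φ (t ^ A)) = τ (φ (t ^ A)) * X := by
    refine Equiv.ext fun ⟨q, f⟩ => ?_
    simp only [Equiv.Perm.mul_apply, hX, hτ, x]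
    rw [hh _ hKt, hα _ (Subgroup.zpow_mem_zpowers t A)]
    simp [mul_assoc]
  have hcW : W * τ (φ (y ^ g)) = τ (φ (y ^ g)) * W := by
    refine Equiv.ext fun ⟨q, f⟩ => ?_
    simp only [Equiv.Perm.mul_apply, hW, hτ, w]
    rw [hh _ hKy, hβ _ (Subgroup.zpow_mem_zpowers y g)]
    simp [mul_assoc]
  have hXA : (X⁻¹ * τ (φ t) * X) ^ A = τ (φ (t ^ A)) := by
    have := conj_zpow (a := X⁻¹) (b := τ (φ t)) (i := A)
    rw [inv_inv] at this
    rw [this, ← map_zpow, ← map_zpow, mul_assoc, ← hcX]; simp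
  have hWg : (W⁻¹ * τ (φ y) * W) ^ g = τ (φ (y ^ g)) := by
    have := conj_zpow (a := W⁻¹) (b := τ (φ y)) (i := g)
    rw [inv_inv] at this
    rw [this, ← map_zpow, ← map_zpow, mul_assoc, ← hcW]; simp
  have hWk : ∀ k : ℤ, (W⁻¹ * τ (φ y) * W) ^ (g * k) = τ (φ (y ^ (g * k))) := by
    intro k
    rw [zpow_mul, hWg, ← map_zpow, ← map_zpow, zpow_mul]
  obtain ⟨Φ, hΦt, hΦy⟩ := E_hom (n := n) (r := r) (s := s) (A := A) (X⁻¹ * τ (φ t) * X)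
    (W⁻¹ * τ (φ y) * W)
    (by
      have := conj_pow (a := X⁻¹) (b := τ (φ t)) (i := n)
      rw [inv_inv] at this
      rw [this, ← map_pow, ← map_pow, E_rel1]; simp)
    (by
      have h1 := hWk rr
      have h2 := hWk ss
      rw [← hr] at h1
      rw [← hs] at h2
      rw [hXA, h1, h2, ← map_mul, ← map_mul, ← map_mul, ← map_mul, E_rel2])
  refine vf_core φ {t, y} (E_gen n r s A) Φ h ?_
  rintro e (rfl | rfl) q
  · refine ⟨(x (φ t * q))⁻¹ * x q, ?_, ?_⟩
    · intro f
      rw [hΦt]; simp only [Equiv.Perm.mul_apply, hX, hX', hτ, mul_assoc]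
    · simp [x, hα _ (Subgroup.mem_zpowers t), mul_assoc]
  · refine ⟨(w (φ y * q))⁻¹ * w q, ?_, ?_⟩
    · intro f
      rw [hΦy]; simp only [Equiv.Perm.mul_apply, hW, hW', hτ, mul_assoc]
    · simp [w, hβ _ (Subgroup.mem_zpowers y), mul_assoc]

theorem exists_c (n m : ℕ) (hm : 0 < m) (A rr ss : ℤ)
    (hA : ∀ k : ℤ, ((k * A : ℤ) : ZMod n) = 0 ↔ (m : ℤ) ∣ k) :
    ∃ c : ZMod n → ℤ, (∀ j, (rr ^ m - ss ^ m) ∣ rr * c (j + A) - ss * c j) ∧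
      (∃ j, c j = rr ^ (m - 1)) ∧ (∃ j, c j = ss ^ (m - 1)) := by
  classical
  let c : ZMod n → ℤ := fun j =>
    if hj : ∃ k : ℕ, k < m ∧ j = ((k * A : ℤ) : ZMod n) then
      rr ^ (m - 1 - hj.choose) * ss ^ hj.choose else 0
  have hc : ∀ k : ℕ, k < m → c ((k * A : ℤ) : ZMod n) = rr ^ (m - 1 - k) * ss ^ k := by
    intro k hk
    have hj : ∃ k' : ℕ, k' < m ∧ ((k * A : ℤ) : ZMod n) = ((k' * A : ℤ) : ZMod n) := ⟨k, hk, rfl⟩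
    have h1 : hj.choose = k := by
      have ⟨h2, h3⟩ := hj.choose_spec
      generalize hj.choose = k' at h2 h3
      have h4 := (hA (k - k')).1 (by push_cast at h3 ⊢; rw [sub_mul, h3, sub_self])
      have := Int.eq_zero_of_abs_lt_dvd h4 (by rw [abs_lt]; constructor <;> omega)
      omega
    simp only [c]
    rw [dif_pos hj, h1]
  have hmA : ((m * A : ℤ) : ZMod n) = 0 := (hA m).2 dvd_rfl
  have hc0 : c 0 = rr ^ (m - 1) := by
    have := hc 0 hm
    simpa using this
  have hcl : c (((m - 1 : ℕ) * A : ℤ) : ZMod n) = ss ^ (m - 1) := by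
    have := hc (m - 1) (by omega)
    rw [this]; simp
  have hlast : (((m - 1 : ℕ) * A : ℤ) : ZMod n) + A = 0 := by
    rw [← hmA]; push_cast [Nat.cast_sub hm]; ring
  refine ⟨c, ?_, ⟨0, hc0⟩, ⟨_, hcl⟩⟩
  intro j
  by_cases hj : ∃ k : ℕ, k < m ∧ j = ((k * A : ℤ) : ZMod n)
  · obtain ⟨k, hk, rfl⟩ := hj
    by_cases hk' : k + 1 < m
    · have e : ((k * A : ℤ) : ZMod n) + A = (((k + 1 : ℕ) * A : ℤ) : ZMod n) := by push_cast; ring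
      rw [e, hc k hk, hc (k + 1) hk']
      obtain ⟨l, rfl⟩ : ∃ l, m = k + 1 + 1 + l := ⟨m - (k + 2), by omega⟩
      have e1 : k + 1 + 1 + l - 1 - k = l + 1 := by omega
      have e2 : k + 1 + 1 + l - 1 - (k + 1) = l := by omega
      rw [e1, e2]
      have : rr * (rr ^ l * ss ^ (k + 1)) - ss * (rr ^ (l + 1) * ss ^ k) = 0 := by ring
      rw [this]; exact dvd_zero _
    · obtain rfl : k = m - 1 := by omega
      rw [hlast, hc0, hcl, ← pow_succ', ← pow_succ', Nat.sub_add_cancel hm]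
  · have hj2 : ¬ ∃ k : ℕ, k < m ∧ j + A = ((k * A : ℤ) : ZMod n) := by
      rintro ⟨k, hk, hk'⟩
      rcases k with _ | k
      · refine hj ⟨m - 1, by omega, ?_⟩
        have : j + A = 0 := by simpa using hk'
        exact add_right_cancel (this.trans hlast.symm)
      · refine hj ⟨k, by omega, ?_⟩
        refine add_right_cancel (b := (A : ZMod n)) (hk'.trans ?_)
        push_cast; ring
    simp only [c]
    rw [dif_neg hj, dif_neg hj2]; simp

theorem exists_phi (n m : ℕ) (hn : 0 < n) (hm : 0 < m) (r s A g rr ss : ℤ)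
    (hr : r = g * rr) (hs : s = g * ss) (hg : g ≠ 0) (hco : IsCoprime rr ss)
    (hN : rr ^ m - ss ^ m ≠ 0)
    (hA : ∀ k : ℤ, ((k * A : ℤ) : ZMod n) = 0 ↔ (m : ℤ) ∣ k) :
    ∃ (Q : Type) (_ : Group Q) (_ : Finite Q) (φ : PresentedGroup (Erels n r s A) →* Q),
      ∀ i j : ℤ, φ (PresentedGroup.of false ^ i * PresentedGroup.of true ^ j) = 1 →
        (n : ℤ) ∣ j ∧ g * (rr ^ m - ss ^ m) ∣ i := by
  obtain ⟨c, hc, ⟨j1, hj1⟩, ⟨j2, hj2⟩⟩ := exists_c n m hm A rr ss hA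
  set N := rr ^ m - ss ^ m with hNdef
  let M : ℕ := (g * N).natAbs
  have : NeZero n := ⟨hn.ne'⟩
  have : NeZero M := ⟨by simp [M, hg, hN]⟩
  have hM : ∀ a : ℤ, (a : ZMod M) = 0 ↔ g * N ∣ a := by
    intro a
    rw [ZMod.intCast_zmod_eq_zero_iff_dvd, Int.natAbs_dvd]
  let T : Equiv.Perm (ZMod n × ZMod M) := Equiv.prodCongr (Equiv.addRight 1) (Equiv.refl _)
  let Y : Equiv.Perm (ZMod n × ZMod M) :=
    Equiv.prodShear (Equiv.refl _) (fun j => Equiv.addRight (c j : ZMod M))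
  have hT1 : ∀ a v, T (a, v) = (a + 1, v) := fun a v => rfl
  have hY1 : ∀ a v, Y (a, v) = (a, v + c a) := fun a v => rfl
  have hT : ∀ (k : ℤ) a v, (T ^ k) (a, v) = (a + k, v) := by
    intro k
    induction k using Int.induction_on with
    | zero => simp
    | succ i ih => intro a v; rw [zpow_add_one, Equiv.Perm.mul_apply, hT1, ih]; push_cast; ring_nf
    | pred i ih =>
      intro a v
      have : T⁻¹ (a, v) = (a - 1, v) := by rw [Equiv.Perm.inv_eq_iff_eq, hT1]; simp
      rw [zpow_sub_one, Equiv.Perm.mul_apply, this, ih]; push_cast; ring_nf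
  have hY : ∀ (k : ℤ) a v, (Y ^ k) (a, v) = (a, v + ((k * c a : ℤ) : ZMod M)) := by
    intro k
    induction k using Int.induction_on with
    | zero => simp
    | succ i ih => intro a v; rw [zpow_add_one, Equiv.Perm.mul_apply, hY1, ih]; push_cast; ring_nf
    | pred i ih =>
      intro a v
      have : Y⁻¹ (a, v) = (a, v - c a) := by rw [Equiv.Perm.inv_eq_iff_eq, hY1]; simp
      rw [zpow_sub_one, Equiv.Perm.mul_apply, this, ih]; push_cast; ring_nf
  obtain ⟨φ, hφt, hφy⟩ := E_hom (n := n) (r := r) (s := s) (A := A) T Y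
    (by
      refine Equiv.ext fun ⟨a, v⟩ => ?_
      rw [← zpow_natCast, hT]; simp)
    (by
      refine Equiv.ext fun ⟨a, v⟩ => ?_
      rw [Equiv.Perm.mul_apply, Equiv.Perm.mul_apply, hT, hY, hY, hT]
      have : ((r * c (a + A) : ℤ) : ZMod M) = ((s * c a : ℤ) : ZMod M) := by
        rw [← sub_eq_zero, ← Int.cast_sub, hM, hr, hs, mul_assoc, mul_assoc, ← mul_sub]
        exact mul_dvd_mul_left g (hc a)
      rw [this])
  refine ⟨_, inferInstance, inferInstance, φ, ?_⟩
  intro i j hij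
  rw [map_mul, map_zpow, map_zpow, hφt, hφy] at hij
  have key : ∀ a, (j : ZMod n) = 0 ∧ g * N ∣ i * c (a + j) := by
    intro a
    have h1 : (Y ^ i * T ^ j) (a, 0) = (a, 0) := by rw [hij]; rfl
    rw [Equiv.Perm.mul_apply, hT, hY, Prod.mk.injEq, zero_add, hM] at h1
    exact ⟨by simpa using h1.1, h1.2⟩
  have hj : (j : ZMod n) = 0 := (key 0).1
  refine ⟨(ZMod.intCast_zmod_eq_zero_iff_dvd _ _).1 hj, ?_⟩
  have k1 := (key j1).2
  have k2 := (key j2).2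
  rw [hj, add_zero] at k1 k2
  rw [hj1] at k1
  rw [hj2] at k2
  obtain ⟨a, b, hab⟩ : IsCoprime (rr ^ (m - 1)) (ss ^ (m - 1)) := hco.pow
  have : i = a * (i * rr ^ (m - 1)) + b * (i * ss ^ (m - 1)) := by
    linear_combination (-i) * hab
  rw [this]
  exact dvd_add (dvd_mul_of_dvd_right k1 _) (dvd_mul_of_dvd_right k2 _)

/-- If `z ^ p = u z ^ q u⁻¹`, then powers iterate. -/
theorem conj_iter {G : Type} [Group G] (u z : G) (p q : ℤ) (h : z ^ p = u * z ^ q * u⁻¹) (k : ℕ) :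
    z ^ (p ^ k) = u ^ k * z ^ (q ^ k) * (u ^ k)⁻¹ := by
  induction k with
  | zero => simp
  | succ k ih =>
    have h2 : ∀ l : ℤ, z ^ (p * l) = u * z ^ (q * l) * u⁻¹ := by
      intro l; rw [zpow_mul, h, conj_zpow, zpow_mul]
    rw [pow_succ, zpow_mul, ih, conj_zpow, ← zpow_mul, mul_comm (q ^ k) p, h2, pow_succ u,
      pow_succ' q]
    group

/-- if `r^{n/(n,A)} ≠ s^{n/(n,A)}` (or `r = s = 0`), then
`E = ⟨t,y | t^n, y^r t^A y^{-s} t^{-A}⟩` is virtually free: it has a free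
subgroup of finite index. -/
theorem stmt_14 (n : ℕ) (hn : 0 < n) (r s A : ℤ)
    (h : r ^ (n / Int.gcd (n : ℤ) A) ≠ s ^ (n / Int.gcd (n : ℤ) A) ∨ (r = 0 ∧ s = 0)) :
    ∃ (F : Subgroup (PresentedGroup (Erels n r s A))) (ι : Type),
      F.FiniteIndex ∧ Nonempty (F ≃* FreeGroup ι) := by
  rcases h with h | ⟨rfl, rfl⟩
  swap
  · exact E_zero n hn A
  set m := n / Int.gcd (n : ℤ) A with hmdef
  have hd : Int.gcd (n : ℤ) A ∣ n := by
    have := Int.gcd_dvd_left (n : ℤ) A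
    exact_mod_cast this
  have hd0 : 0 < Int.gcd (n : ℤ) A := Nat.pos_of_dvd_of_pos hd hn
  have hm : 0 < m := Nat.div_pos (Nat.le_of_dvd hn hd) hd0
  have hnm : (n : ℤ) = Int.gcd (n : ℤ) A * m := by
    have := Nat.mul_div_cancel' hd
    exact_mod_cast this.symm
  obtain ⟨a, ha⟩ := Int.gcd_dvd_right (n : ℤ) A
  have hma : IsCoprime (m : ℤ) a := by
    obtain ⟨p, q, hpq⟩ := (⟨_, _, (Int.gcd_eq_gcd_ab (n : ℤ) A)⟩ :
      ∃ p q, ((Int.gcd (n : ℤ) A : ℕ) : ℤ) = n * p + A * q)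
    generalize Int.gcd (n : ℤ) A = d at *
    refine ⟨p, q, ?_⟩
    have hd' : (d : ℤ) ≠ 0 := by exact_mod_cast hd0.ne'
    apply mul_left_cancel₀ hd'
    rw [hnm, ha] at hpq
    linear_combination -hpq
  have hA : ∀ k : ℤ, ((k * A : ℤ) : ZMod n) = 0 ↔ (m : ℤ) ∣ k := by
    intro k
    rw [ZMod.intCast_zmod_eq_zero_iff_dvd]
    have e : k * A = Int.gcd (n : ℤ) A * (k * a) := by
      linear_combination k * ha
    rw [e]
    nth_rw 1 [hnm]
    rw [mul_dvd_mul_iff_left (by exact_mod_cast hd0.ne')]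
    exact ⟨fun h => hma.dvd_of_dvd_mul_right h, fun h => Dvd.dvd.mul_right h _⟩
  have hg0 : 0 < Int.gcd r s := by
    rw [Int.gcd_pos_iff]
    by_contra hcon
    push Not at hcon
    exact h (by rw [hcon.1, hcon.2])
  obtain ⟨g, rr, ss, hg, hco, hr, hs⟩ : ∃ g rr ss : ℤ, g ≠ 0 ∧ IsCoprime rr ss ∧
      r = g * rr ∧ s = g * ss := by
    obtain ⟨rr, ss, h1, h2, h3⟩ := Int.exists_gcd_one hg0
    refine ⟨Int.gcd r s, rr, ss, by exact_mod_cast hg0.ne', Int.isCoprime_iff_gcd_eq_one.2 h1,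
      by rw [mul_comm]; exact h2, by rw [mul_comm]; exact h3⟩
  have hN : rr ^ m - ss ^ m ≠ 0 := by
    intro h0
    apply h
    rw [hr, hs, mul_pow, mul_pow, sub_eq_zero.1 h0]
  obtain ⟨Q, _, _, φ, hφ⟩ := exists_phi n m hn hm r s A g rr ss hr hs hg hco hN hA
  set t : PresentedGroup (Erels n r s A) := PresentedGroup.of true with ht
  set y : PresentedGroup (Erels n r s A) := PresentedGroup.of false with hy
  have htn : ∀ j : ℤ, (n : ℤ) ∣ j → t ^ j = 1 := by
    rintro _ ⟨j, rfl⟩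
    rw [zpow_mul, zpow_natCast, E_rel1, one_zpow]
  have hrel : (y ^ g) ^ rr = t ^ A * (y ^ g) ^ ss * (t ^ A)⁻¹ := by
    rw [eq_mul_inv_iff_mul_eq, ← zpow_mul, ← zpow_mul, ← hr, ← hs]
    exact E_rel2 n r s A
  have hum : (t ^ A) ^ m = 1 := by
    rw [← zpow_natCast, ← zpow_mul]
    apply htn
    rw [mul_comm, ← ZMod.intCast_zmod_eq_zero_iff_dvd, hA]
  have hyN : ∀ i : ℤ, g * (rr ^ m - ss ^ m) ∣ i → y ^ i = 1 := by
    rintro _ ⟨i, rfl⟩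
    have := conj_iter _ _ _ _ hrel m
    rw [hum, one_mul, inv_one, mul_one] at this
    rw [zpow_mul, zpow_mul, zpow_sub, this, mul_inv_cancel, one_zpow]
  have hzN : ∀ i : ℤ, (rr ^ m - ss ^ m) ∣ i → (y ^ g) ^ i = 1 := by
    intro i hi
    rw [← zpow_mul]
    exact hyN _ (mul_dvd_mul_left g hi)
  have hcs : IsCoprime ss (rr ^ m - ss ^ m) := by
    have h1 : IsCoprime ss (rr ^ m) := hco.symm.pow_right
    obtain ⟨l, hl⟩ : ∃ l, m = l + 1 := ⟨m - 1, by omega⟩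
    rw [hl] at h1 ⊢
    have := h1.add_mul_left_right (-ss ^ l)
    have e : rr ^ (l + 1) - ss ^ (l + 1) = rr ^ (l + 1) + ss * (-ss ^ l) := by ring
    rw [e]; exact this
  have hcr : IsCoprime rr (rr ^ m - ss ^ m) := by
    have h1 : IsCoprime rr (-ss ^ m) := hco.pow_right.neg_right
    obtain ⟨l, hl⟩ : ∃ l, m = l + 1 := ⟨m - 1, by omega⟩
    rw [hl] at h1 ⊢
    have := h1.add_mul_left_right (rr ^ l)
    have e : rr ^ (l + 1) - ss ^ (l + 1) = -ss ^ (l + 1) + rr * (rr ^ l) := by ring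
    rw [e]; exact this
  have hdown : ∀ k, IsCoprime k (rr ^ m - ss ^ m) → ∃ p : ℤ, y ^ g = ((y ^ g) ^ k) ^ p := by
    rintro k ⟨p, q, hpq⟩
    refine ⟨p, ?_⟩
    have e : k * p = 1 - q * (rr ^ m - ss ^ m) := by linear_combination hpq
    rw [← zpow_mul, e, zpow_sub, hzN _ (Dvd.intro_left _ rfl)]; simp
  have hnorm : Subgroup.zpowers (t ^ A) ≤ Subgroup.normalizer (Subgroup.zpowers (y ^ g)) := by
    rw [Subgroup.zpowers_le, Subgroup.mem_normalizer_iff]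
    obtain ⟨p, hp⟩ := hdown ss hcs
    obtain ⟨p', hp'⟩ := hdown rr hcr
    intro x
    constructor
    · rintro ⟨i, rfl⟩
      refine ⟨rr * p * i, ?_⟩
      show (y ^ g) ^ (rr * p * i) = t ^ A * (y ^ g) ^ i * (t ^ A)⁻¹
      rw [zpow_mul, zpow_mul, hrel, conj_zpow, conj_zpow, ← hp]
    · rintro ⟨i, hi⟩
      refine ⟨ss * p' * i, ?_⟩
      have hi : (y ^ g) ^ i = t ^ A * x * (t ^ A)⁻¹ := hi
      show (y ^ g) ^ (ss * p' * i) = x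
      have e2 : (y ^ g) ^ ss = (t ^ A)⁻¹ * (y ^ g) ^ rr * (t ^ A)⁻¹⁻¹ := by rw [hrel]; group
      rw [zpow_mul, zpow_mul, e2, conj_zpow, conj_zpow, ← hp', hi]
      group
  refine E_main n r s A g rr ss hr hs φ (Subgroup.zpowers (y ^ g) ⊔ Subgroup.zpowers (t ^ A))
    (Subgroup.mem_sup_right (Subgroup.mem_zpowers _))
    (Subgroup.mem_sup_left (Subgroup.mem_zpowers _)) ?_ ?_ ?_
  · intro k hk hk1
    rw [← SetLike.mem_coe, Subgroup.coe_mul_of_right_le_normalizer_left _ _ hnorm] at hk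
    obtain ⟨_, ⟨i, rfl⟩, _, ⟨j, rfl⟩, rfl⟩ := hk
    simp only [← zpow_mul] at hk1 ⊢
    obtain ⟨h1, h2⟩ := hφ _ _ hk1
    rw [htn _ h1, hyN _ h2, one_mul]
  · rintro _ ⟨j, rfl⟩ hk1
    exact htn j (hφ 0 j (by simpa using hk1)).1
  · rintro _ ⟨j, rfl⟩ hk1
    exact hyN j (hφ j 0 (by simpa using hk1)).2
end

section
/- Every finite subgroup of E = ⟨t,y | t^n, y^r t^A y^{-s} t^{-A}⟩ (n > 0) is metacyclic. -/
/-- A group is metacyclic if it has a cyclic normal subgroup with cyclic quotient. -/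
def IsMetacyclic (G : Type*) [Group G] : Prop :=
  ∃ (K : Subgroup G) (hK : K.Normal),
    IsCyclic K ∧ (let _inst : K.Normal := hK; IsCyclic (G ⧸ K))

open Monoid Monoid.PushoutI

section Amalgam

variable {ι : Type} {G : ι → Type} {C : Type} [∀ i, Group (G i)] [Group C] {φ : ∀ i, C →* G i}

/-- Reduced lists of letters. -/
def Rd (φ : ∀ i, C →* G i) (l : List (Σ i, G i)) : Prop :=
  l.IsChain (fun a b => a.1 ≠ b.1) ∧ ∀ g ∈ l, g.2 ∉ (φ g.1).range

/-- The product of a list of letters. -/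
def pr (φ : ∀ i, C →* G i) (l : List (Σ i, G i)) : PushoutI φ :=
  (l.map (fun g => (PushoutI.of g.1 g.2 : PushoutI φ))).prod

theorem pr_append (l l' : List (Σ i, G i)) : pr φ (l ++ l') = pr φ l * pr φ l' := by
  simp [pr]

theorem pr_cons (x : Σ i, G i) (l : List (Σ i, G i)) :
    pr φ (x :: l) = PushoutI.of x.1 x.2 * pr φ l := by
  simp [pr]

theorem pr_nil : pr φ ([] : List (Σ i, G i)) = 1 := by
  simp [pr]

theorem ofCoprodI_word (w : CoprodI.Word G) :
    (ofCoprodI w.prod : PushoutI φ) = pr φ w.toList := by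
  simp [CoprodI.Word.prod, pr, map_list_prod, Function.comp_def]

/-- `g` has a reduced expression of length at most `N`. -/
def Bd (φ : ∀ i, C →* G i) (N : ℕ) (g : PushoutI φ) : Prop :=
  ∃ c l, Rd φ l ∧ l.length ≤ N ∧ g = base φ c * pr φ l

theorem Bd.mono {N M : ℕ} (h : N ≤ M) {g : PushoutI φ} (hg : Bd φ N g) : Bd φ M g := by
  obtain ⟨c, l, h1, h2, h3⟩ := hg
  exact ⟨c, l, h1, h2.trans h, h3⟩

theorem Rd.normal (d : NormalWord.Transversal φ) {l : List (Σ i, G i)} (hl : Rd φ l) (c : C) :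
    ∃ w : NormalWord d, w.prod = base φ c * pr φ l ∧ w.toList.length = l.length := by
  let w : CoprodI.Word G := ⟨l, fun g hg h1 => hl.2 g hg (h1 ▸ one_mem _), hl.1⟩
  have hw : Reduced φ w := hl.2
  obtain ⟨w', h1, h2⟩ := hw.exists_normalWord_prod_eq d
  refine ⟨c • w', ?_, ?_⟩
  · rw [NormalWord.prod_base_smul, h1, ofCoprodI_word]
  · have := congrArg List.length h2
    rw [List.length_map, List.length_map] at this
    exact this

theorem Rd.length_le (hφ : ∀ i, Function.Injective (φ i)) {l : List (Σ i, G i)} (hl : Rd φ l)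
    {N : ℕ} (h : Bd φ N (pr φ l)) : l.length ≤ N := by
  obtain ⟨d⟩ := NormalWord.transversal_nonempty φ hφ
  obtain ⟨c, l', h1, h2, h3⟩ := h
  obtain ⟨w, hw1, hw2⟩ := hl.normal d 1
  obtain ⟨w', hw1', hw2'⟩ := h1.normal d c
  have : w = w' := NormalWord.prod_injective (by rw [hw1, hw1', ← h3]; simp)
  subst this
  omega

theorem exists_Bd (hφ : ∀ i, Function.Injective (φ i)) (g : PushoutI φ) : ∃ N, Bd φ N g := by
  classical
  obtain ⟨d⟩ := NormalWord.transversal_nonempty φ hφ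
  let w : NormalWord d := g • NormalWord.empty
  have hw : w.prod = g := by simp [w]
  refine ⟨_, w.head, w.toList, ⟨w.chain_ne, ?_⟩, le_rfl, ?_⟩
  · rintro ⟨i, x⟩ hx hr
    have h1 := w.normalized _ _ hx
    have h2 := w.ne_one _ hx
    apply h2
    have e1 := (Subgroup.IsComplement.coe_equiv_snd_eq_one_iff_mem (d.compl i) (d.one_mem i)).2 hr
    have e2 := ((d.compl i).equiv_snd_eq_self_iff_mem (one_mem _)).2 h1
    simp only at *
    rw [← e2, e1]
  · rw [← ofCoprodI_word, ← hw]; rfl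

theorem Rd.inv {l : List (Σ i, G i)} (hl : Rd φ l) :
    Rd φ (l.reverse.map (fun x => ⟨x.1, x.2⁻¹⟩)) := by
  constructor
  · rw [List.isChain_map, List.isChain_reverse]
    exact hl.1.imp fun a b h => Ne.symm h
  · simp only [List.mem_map, List.mem_reverse]
    rintro _ ⟨x, hx, rfl⟩ h
    exact hl.2 x hx (by simpa using h)

theorem pr_inv (l : List (Σ i, G i)) :
    pr φ (l.reverse.map (fun x => ⟨x.1, x.2⁻¹⟩)) = (pr φ l)⁻¹ := by
  induction l with
  | nil => simp [pr_nil]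
  | cons a l ih => simp only [List.reverse_cons, List.map_append, pr_append, ih]; simp [pr_cons, pr_nil]

/-- Either in the base or a product of a reduced nonempty list -/
theorem Bd.cases {N : ℕ} {g : PushoutI φ} (hg : Bd φ N g) :
    (∃ c, g = base φ c) ∨ ∃ x l, Rd φ (x :: l) ∧ (x :: l).length ≤ N ∧ g = pr φ (x :: l) := by
  obtain ⟨c, l, h1, h2, h3⟩ := hg
  cases l with
  | nil => left; exact ⟨c, by simpa [pr_nil] using h3⟩
  | cons x l =>
    right
    refine ⟨⟨x.1, φ x.1 c * x.2⟩, l, ⟨?_, ?_⟩, by simpa using h2, ?_⟩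
    · have := h1.1
      simp only [List.isChain_cons] at this ⊢
      exact this
    · intro g hg
      rcases List.mem_cons.1 hg with rfl | hg
      · intro h
        refine h1.2 x (by simp) ?_
        exact ((φ x.1).range.mul_mem_cancel_left (MonoidHom.mem_range.2 ⟨c, rfl⟩)).1 h
      · exact h1.2 g (by simp [hg])
    · rw [h3, pr_cons, pr_cons, map_mul, of_apply_eq_base, mul_assoc]

theorem Bd.mul_base {N : ℕ} {g : PushoutI φ} (hg : Bd φ N g) (c : C) : Bd φ N (g * base φ c) := by
  obtain ⟨c', l, h1, h2, rfl⟩ := hg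
  rcases List.eq_nil_or_concat l with rfl | ⟨l, x, rfl⟩
  · exact ⟨c' * c, [], h1, h2, by simp [pr_nil]⟩
  · refine ⟨c', l ++ [⟨x.1, x.2 * φ x.1 c⟩], ⟨?_, ?_⟩, by simpa using h2, ?_⟩
    · have := h1.1
      simp only [List.concat_eq_append, List.isChain_append] at this ⊢
      simpa using this
    · intro g hg
      rcases List.mem_append.1 hg with hg | hg
      · exact h1.2 g (by simp [hg])
      · simp only [List.mem_singleton] at hg
        subst hg
        intro h
        refine h1.2 x (by simp) ?_
        exact ((φ x.1).range.mul_mem_cancel_right (MonoidHom.mem_range.2 ⟨c, rfl⟩)).1 h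
    · simp [pr_append, pr_cons, pr_nil, mul_assoc, of_apply_eq_base]

theorem Rd.append {l l' : List (Σ i, G i)} (h : Rd φ l) (h' : Rd φ l')
    (hh : ∀ x ∈ l.getLast?, ∀ y ∈ l'.head?, x.1 ≠ y.1) : Rd φ (l ++ l') := by
  refine ⟨List.isChain_append.2 ⟨h.1, h'.1, hh⟩, ?_⟩
  intro g hg
  rcases List.mem_append.1 hg with hg | hg
  · exact h.2 g hg
  · exact h'.2 g hg

theorem Rd.left {l l' : List (Σ i, G i)} (h : Rd φ (l ++ l')) : Rd φ l :=
  ⟨(List.isChain_append.1 h.1).1, fun g hg => h.2 g (by simp [hg])⟩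

theorem Rd.right {l l' : List (Σ i, G i)} (h : Rd φ (l ++ l')) : Rd φ l' :=
  ⟨(List.isChain_append.1 h.1).2.1, fun g hg => h.2 g (by simp [hg])⟩

theorem Rd.last {l : List (Σ i, G i)} {i : ι} {b b' : G i} (h : Rd φ (l ++ [⟨i, b⟩]))
    (hb : b' ∉ (φ i).range) : Rd φ (l ++ [⟨i, b'⟩]) := by
  refine h.left.append ⟨by simp, by simpa using hb⟩ ?_
  have := (List.isChain_append.1 h.1).2.2
  simpa using this

theorem conj_step (hφ : ∀ i, Function.Injective (φ i)) (H : Subgroup (PushoutI φ)) (N : ℕ)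
    (hN : 2 ≤ N) (hH : ∀ h ∈ H, Bd φ N h) (v : List (Σ i, G i)) (i : ι) (b : G i)
    (hv : Rd φ (v ++ [⟨i, b⟩])) (hlen : (v ++ [(⟨i, b⟩ : Σ i, G i)]).length = N)
    (hm : pr φ (v ++ [⟨i, b⟩]) ∈ H) (k : PushoutI φ) (hk : k ∈ H) :
    Bd φ (N - 1) (PushoutI.of i b * k * (PushoutI.of i b)⁻¹) := by
  have hG : ∀ x : G i, Bd φ (N - 1) (PushoutI.of i b * PushoutI.of i x * (PushoutI.of i b)⁻¹) := by
    intro x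
    rw [← map_inv, ← map_mul, ← map_mul]
    by_cases hx : b * x * b⁻¹ ∈ (φ i).range
    · obtain ⟨c, hc⟩ := hx
      refine ⟨c, [], ⟨by simp, by simp⟩, by simp, ?_⟩
      rw [← hc, of_apply_eq_base, pr_nil, mul_one]
    · refine ⟨1, [⟨i, b * x * b⁻¹⟩], ⟨by simp, by simpa using hx⟩, by simp; omega, ?_⟩
      simp [pr_cons, pr_nil]
  rcases (hH k hk).cases with ⟨c, rfl⟩ | ⟨⟨j, x⟩, l, hl, hlN, rfl⟩
  · rw [← of_apply_eq_base φ i c]; exact hG _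
  by_cases hij : i = j
  swap
  · exfalso
    have := (hv.append hl (by simpa using hij)).length_le hφ
      (by rw [pr_append]; exact hH _ (mul_mem hm hk))
    simp at this hlen
    omega
  subst hij
  rcases List.eq_nil_or_concat l with rfl | ⟨l, ⟨j, y⟩, rfl⟩
  · simpa [pr_cons, pr_nil] using hG x
  rw [List.concat_eq_append] at *
  have hl2 : Rd φ (l ++ [⟨j, y⟩]) := Rd.right (l := [⟨i, x⟩]) (by simpa using hl)
  by_cases hij : i = j
  swap
  · exfalso
    have := (hl.append hv.inv (by
      rw [← List.cons_append, List.getLast?_concat]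
      simp [Ne.symm hij])).length_le hφ
      (by rw [pr_append, pr_inv]; exact hH _ (mul_mem hk (inv_mem hm)))
    simp at this hlen
    omega
  subst hij
  by_cases hbx : b * x ∈ (φ i).range
  swap
  · exfalso
    have h1 := (hv.last hbx).append hl2 (by
      have := hl.1
      rw [List.isChain_cons] at this
      simpa using this.1)
    have := h1.length_le hφ (N := N) (by
      have := hH _ (mul_mem hm hk)
      simpa [pr_append, pr_cons, pr_nil, mul_assoc] using this)
    simp at this hlen
    omega
  obtain ⟨c, hc⟩ := hbx
  have e : PushoutI.of i b * pr φ (⟨i, x⟩ :: (l ++ [⟨i, y⟩])) * (PushoutI.of i b)⁻¹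
      = base φ c * pr φ l * PushoutI.of i (y * b⁻¹) := by
    rw [← of_apply_eq_base φ i c, hc]
    simp [pr_append, pr_cons, pr_nil, mul_assoc]
  rw [e]
  simp at hlN
  by_cases hyb : y * b⁻¹ ∈ (φ i).range
  · obtain ⟨c', hc'⟩ := hyb
    rw [← hc', of_apply_eq_base]
    exact Bd.mul_base ⟨c, l, hl2.left, by omega, rfl⟩ c'
  · refine ⟨c, _, hl2.last hyb, by simp; omega, ?_⟩
    simp [pr_append, pr_cons, pr_nil, mul_assoc]

theorem conj_factor_aux [Nonempty ι] (hφ : ∀ i, Function.Injective (φ i)) (N : ℕ) :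
    ∀ (H : Subgroup (PushoutI φ)), (∀ h ∈ H, Bd φ (N + 1) h) →
    ∃ (i : ι) (g : PushoutI φ), ∀ h ∈ H, g * h * g⁻¹ ∈ (PushoutI.of (φ := φ) i).range := by
  induction N with
  | zero =>
    intro H hH
    by_cases hb : ∀ h ∈ H, ∃ c, h = base φ c
    · inhabit ι
      refine ⟨default, 1, fun h hh => ?_⟩
      obtain ⟨c, rfl⟩ := hb h hh
      exact ⟨φ _ c, by simp [of_apply_eq_base]⟩
    · push Not at hb
      obtain ⟨h, hh, hc⟩ := hb
      rcases (hH h hh).cases with ⟨c, rfl⟩ | ⟨⟨i, x⟩, l, hl, hlN, rfl⟩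
      · exact absurd rfl (hc c)
      have : l = [] := by simpa using hlN
      subst this
      refine ⟨i, 1, fun k hk => ?_⟩
      rcases (hH k hk).cases with ⟨c, rfl⟩ | ⟨⟨j, y⟩, l, hl', hlN', rfl⟩
      · exact ⟨φ _ c, by simp [of_apply_eq_base]⟩
      have : l = [] := by simpa using hlN'
      subst this
      by_cases hij : i = j
      · subst hij
        exact ⟨y, by simp [pr_cons, pr_nil]⟩
      · exfalso
        have := (hl.append hl' (by simpa using hij)).length_le hφ
          (by rw [pr_append]; exact hH _ (mul_mem hh hk))
        simp at this
  | succ N ih =>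
    intro H hH
    by_cases hb : ∀ h ∈ H, Bd φ (N + 1) h
    · exact ih H hb
    push Not at hb
    obtain ⟨h, hh, hc⟩ := hb
    rcases (hH h hh).cases with ⟨c, rfl⟩ | ⟨x, l, hl, hlN, rfl⟩
    · exact absurd ⟨c, [], ⟨by simp, by simp⟩, by simp, by simp [pr_nil]⟩ hc
    have hlen : (x :: l).length = N + 2 := by
      by_contra hne
      exact hc ⟨1, x :: l, hl, by omega, by simp⟩
    obtain ⟨v, ⟨i, b⟩, hvb⟩ : ∃ v b, x :: l = v ++ [b] := by
      rcases List.eq_nil_or_concat (x :: l) with h | ⟨v, b, h⟩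
      · simp at h
      · exact ⟨v, b, by simpa using h⟩
    rw [hvb] at hl hlen hh
    have key := conj_step hφ H (N + 2) (by omega) hH v i b hl hlen hh
    obtain ⟨j, g, hg⟩ := ih (H.map (MulAut.conj (PushoutI.of (φ := φ) i b)).toMonoidHom) (by
      rintro _ ⟨k, hk, rfl⟩
      simpa using key k hk)
    refine ⟨j, g * PushoutI.of i b, fun k hk => ?_⟩
    have := hg _ ⟨k, hk, rfl⟩
    simpa [mul_assoc] using this

theorem conj_factor [Nonempty ι] (hφ : ∀ i, Function.Injective (φ i))
    (H : Subgroup (PushoutI φ)) (hH : Finite H) :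
    ∃ (i : ι) (g : PushoutI φ), ∀ h ∈ H, g * h * g⁻¹ ∈ (PushoutI.of (φ := φ) i).range := by
  choose f hf using exists_Bd hφ
  obtain ⟨M, hM⟩ := (Set.finite_range (fun h : H => f h)).bddAbove
  refine conj_factor_aux hφ M H fun h hh => (hf h).mono ?_
  have := hM ⟨⟨h, hh⟩, rfl⟩
  simp only at this
  omega

end Amalgam

section Meta

/-- Every finite subgroup is metacyclic. -/
def FM (G : Type) [Group G] : Prop := ∀ H : Subgroup G, Finite H → IsMetacyclic H

theorem IsMetacyclic.of_inj {L M : Type} [Group L] [Group M] (f : L →* M)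
    (hf : Function.Injective f) (h : IsMetacyclic M) : IsMetacyclic L := by
  obtain ⟨K, hK, h1, h2⟩ := h
  simp only at h2
  refine ⟨K.comap f, hK.comap f, ?_, ?_⟩
  · refine isCyclic_of_injective (f.subgroupComap K) ?_
    intro a b hab
    exact Subtype.ext (hf (congrArg Subtype.val hab))
  · have := hK.comap f
    change IsCyclic (L ⧸ K.comap f)
    refine isCyclic_of_injective (QuotientGroup.map (K.comap f) K f le_rfl) ?_
    rw [injective_iff_map_eq_one]
    intro q
    induction q using QuotientGroup.induction_on with
    | H g =>
      intro hg
      rw [QuotientGroup.map_mk, QuotientGroup.eq_one_iff] at hg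
      exact (QuotientGroup.eq_one_iff g).2 hg

theorem FM.of_inj {L M : Type} [Group L] [Group M] (f : L →* M)
    (hf : Function.Injective f) (h : FM M) : FM L := by
  intro H hH
  have : Finite (H.map f) := Finite.of_surjective _ (f.subgroupMap_surjective H)
  refine (h (H.map f) this).of_inj (f.subgroupMap H) ?_
  intro a b hab
  exact Subtype.ext (hf (congrArg Subtype.val hab))

theorem IsMetacyclic.fm {L : Type} [Group L] (h : IsMetacyclic L) : FM L :=
  fun H _ => h.of_inj H.subtype H.subtype_injective

theorem IsMetacyclic.of_cyclic (L : Type) [Group L] [IsCyclic L] : IsMetacyclic L := by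
  refine ⟨⊤, inferInstance, inferInstance, ?_⟩
  exact isCyclic_of_surjective (QuotientGroup.mk' (⊤ : Subgroup L)) (QuotientGroup.mk'_surjective _)

theorem FM.pushout {ι : Type} [Nonempty ι] {G : ι → Type} {C : Type} [∀ i, Group (G i)] [Group C]
    {φ : ∀ i, C →* G i} (hφ : ∀ i, Function.Injective (φ i)) (h : ∀ i, FM (G i)) :
    FM (PushoutI φ) := by
  intro H hH
  obtain ⟨i, g, hg⟩ := conj_factor hφ H hH
  have hinj := PushoutI.of_injective hφ i
  have h1 : FM (PushoutI.of (φ := φ) i).range :=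
    FM.of_inj (MonoidHom.ofInjective hinj).symm.toMonoidHom
      (MonoidHom.ofInjective hinj).symm.injective (h i)
  let ψ : H →* (PushoutI.of (φ := φ) i).range :=
    ((MulAut.conj g).toMonoidHom.comp H.subtype).codRestrict _ (fun k => by
      simpa using hg k.1 k.2)
  have hψ : Function.Injective ψ := by
    intro a b hab
    have := congrArg Subtype.val hab
    apply Subtype.ext
    simpa [ψ] using this
  have : Finite ψ.range := Finite.of_surjective _ ψ.rangeRestrict_surjective
  exact (h1 ψ.range this).of_inj ψ.rangeRestrict (ψ.rangeRestrict_injective_iff.2 hψ)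

/-- A two-element family of types. -/
def Fam (G₁ G₂ : Type) : Bool → Type
  | true => G₁
  | false => G₂

instance famGroup (G₁ G₂ : Type) [h₁ : Group G₁] [h₂ : Group G₂] (b : Bool) :
    Group (Fam G₁ G₂ b) :=
  match b with
  | true => h₁
  | false => h₂

/-- The two projections. -/
def famHom {G₁ G₂ : Type} [Group G₁] [Group G₂] (S : Subgroup (G₁ × G₂)) (b : Bool) :
    S →* Fam G₁ G₂ b :=
  match b with
  | true => (MonoidHom.fst G₁ G₂).comp S.subtype
  | false => (MonoidHom.snd G₁ G₂).comp S.subtype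

theorem exists_amalgam {G₁ G₂ : Type} [Group G₁] [Group G₂] (a : G₁) (b : G₂)
    (hab : orderOf a = orderOf b) (h₁ : FM G₁) (h₂ : FM G₂) :
    ∃ (Q : Type) (_ : Group Q) (i₁ : G₁ →* Q) (i₂ : G₂ →* Q),
      Function.Injective i₁ ∧ i₁ a = i₂ b ∧ FM Q ∧
      ∀ (E : Type) [Group E] (f₁ : G₁ →* E) (f₂ : G₂ →* E), f₁ a = f₂ b →
        ∃ F : Q →* E, (∀ x, F (i₁ x) = f₁ x) ∧ (∀ x, F (i₂ x) = f₂ x) := by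
  let S : Subgroup (G₁ × G₂) := Subgroup.zpowers (a, b)
  have hφ : ∀ i, Function.Injective (famHom S i) := by
    intro i
    rw [injective_iff_map_eq_one]
    rintro ⟨_, k, rfl⟩ hk
    have key : a ^ k = 1 ↔ b ^ k = 1 := by
      rw [← orderOf_dvd_iff_zpow_eq_one, ← orderOf_dvd_iff_zpow_eq_one, hab]
    cases i with
    | true =>
      have h : a ^ k = 1 := hk
      exact Subtype.ext (Prod.ext h (key.1 h))
    | false =>
      have h : b ^ k = 1 := hk
      exact Subtype.ext (Prod.ext (key.2 h) h)
  refine ⟨PushoutI (famHom S), inferInstance, PushoutI.of (φ := famHom S) true,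
    PushoutI.of (φ := famHom S) false, PushoutI.of_injective hφ true, ?_, ?_, ?_⟩
  · let s : S := ⟨(a, b), Subgroup.mem_zpowers _⟩
    exact (of_apply_eq_base (famHom S) true s).trans (of_apply_eq_base (famHom S) false s).symm
  · refine FM.pushout hφ ?_
    rintro (_ | _)
    · exact h₂
    · exact h₁
  · intro E _ f₁ f₂ hf
    let f : ∀ i, Fam G₁ G₂ i →* E := fun i => match i with
      | true => f₁
      | false => f₂
    refine ⟨PushoutI.lift f (f₁.comp ((MonoidHom.fst G₁ G₂).comp S.subtype)) ?_, ?_, ?_⟩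
    · rintro (_ | _)
      · ext ⟨_, k, rfl⟩
        change f₂ (b ^ k) = f₁ (a ^ k)
        rw [map_zpow, map_zpow, hf]
      · rfl
    · intro x
      exact PushoutI.lift_of (φ := famHom S) f _ _ (i := true) x
    · intro x
      exact PushoutI.lift_of (φ := famHom S) f _ _ (i := false) x

end Meta

section Main

theorem exists_cyclic_hom (k : ℕ) {E : Type} [Group E] (g : E) (hg : g ^ k = 1) :
    ∃ f : Multiplicative (ZMod k) →* E, f (Multiplicative.ofAdd 1) = g := by
  let f0 : ZMod k →+ Additive E := ZMod.lift k ⟨zmultiplesHom (Additive E) (Additive.ofMul g), by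
    simp only [zmultiplesHom_apply, natCast_zsmul]
    rw [← ofMul_pow, hg]; rfl⟩
  refine ⟨AddMonoidHom.toMultiplicativeLeft f0, ?_⟩
  have : f0 ((1 : ℤ) : ZMod k) = Additive.ofMul g := by
    rw [ZMod.lift_coe]; simp
  rw [Int.cast_one] at this
  change (f0 1).toMul = g
  rw [this]; rfl

theorem orderOf_gen (k : ℕ) : orderOf (Multiplicative.ofAdd (1 : ZMod k)) = k := by
  rw [orderOf_ofAdd_eq_addOrderOf, ZMod.addOrderOf_one]

variable {n : ℕ} {r s A : ℤ}

/-- The generator `t`. -/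
def eT (n : ℕ) (r s A : ℤ) : PresentedGroup (Erels n r s A) := PresentedGroup.of true
/-- The generator `y`. -/
def eY (n : ℕ) (r s A : ℤ) : PresentedGroup (Erels n r s A) := PresentedGroup.of false

theorem eT_pow : eT n r s A ^ n = 1 := by
  have : (PresentedGroup.mk (Erels n r s A)) (FreeGroup.of true ^ (n : ℤ)) = 1 :=
    PresentedGroup.one_of_mem (by simp [Erels])
  rw [map_zpow, zpow_natCast] at this
  exact this

theorem eY_rel : eT n r s A ^ A * eY n r s A ^ s * (eT n r s A ^ A)⁻¹ = eY n r s A ^ r := by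
  have : (PresentedGroup.mk (Erels n r s A)) (FreeGroup.of false ^ r * FreeGroup.of true ^ A *
     FreeGroup.of false ^ (-s) * FreeGroup.of true ^ (-A)) = 1 :=
    PresentedGroup.one_of_mem (by simp [Erels])
  simp only [map_mul, map_zpow] at this
  change eY n r s A ^ r * eT n r s A ^ A * eY n r s A ^ (-s) * eT n r s A ^ (-A) = 1 at this
  rw [zpow_neg, zpow_neg, mul_inv_eq_one, mul_inv_eq_iff_eq_mul] at this
  rw [mul_inv_eq_iff_eq_mul, this]

theorem exists_E_hom {E : Type} [Group E] (t y : E) (ht : t ^ n = 1)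
    (hy : t ^ A * y ^ s * (t ^ A)⁻¹ = y ^ r) :
    ∃ f : PresentedGroup (Erels n r s A) →* E, f (eT n r s A) = t ∧ f (eY n r s A) = y := by
  let g : Bool → E := fun b => if b then t else y
  have hg : ∀ w ∈ Erels n r s A, FreeGroup.lift g w = 1 := by
    intro w hw
    simp only [Erels, Set.mem_insert_iff, Set.mem_singleton_iff] at hw
    rcases hw with rfl | rfl
    · simpa [g] using ht
    · simp only [map_mul, map_zpow, FreeGroup.lift_apply_of, g, if_true]
      simp [← hy]
  exact ⟨PresentedGroup.toGroup hg, by simp [eT, g], by simp [eY, g]⟩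

theorem E_top (S : Subgroup (PresentedGroup (Erels n r s A))) (h1 : eT n r s A ∈ S)
    (h2 : eY n r s A ∈ S) : S = ⊤ := by
  rw [eq_top_iff, ← PresentedGroup.closure_range_of, Subgroup.closure_le]
  rintro _ ⟨b, rfl⟩
  cases b with
  | true => exact h1
  | false => exact h2

theorem conj_pow_rel {G : Type} [Group G] (x z : G) (r s : ℤ)
    (h : x * z ^ s * x⁻¹ = z ^ r) (k : ℕ) :
    x ^ k * z ^ (s ^ k) * (x ^ k)⁻¹ = z ^ (r ^ k) := by
  induction k with
  | zero => simp
  | succ k ih =>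
    have e1 : x ^ (k + 1) * z ^ (s ^ (k + 1)) * (x ^ (k + 1))⁻¹
        = x * (x ^ k * z ^ (s ^ k) * (x ^ k)⁻¹) ^ s * x⁻¹ := by
      rw [conj_zpow, ← zpow_mul, ← pow_succ, pow_succ' x]
      group
    rw [e1, ih, ← zpow_mul, mul_comm, zpow_mul, ← conj_zpow, h, ← zpow_mul, pow_succ' r]

theorem conj_mem_aux {G : Type} [Group G] (x z : G) (r s D : ℤ)
    (h : x * z ^ s * x⁻¹ = z ^ r) (hD : z ^ D = 1) (hc : IsCoprime s D) :
    x * z * x⁻¹ ∈ Subgroup.zpowers z := by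
  obtain ⟨u, v, huv⟩ := hc
  have e : z = (z ^ s) ^ u := by
    have : z ^ (u * s + v * D) = z := by rw [huv, zpow_one]
    rw [zpow_add, mul_comm v, zpow_mul z D, hD, one_zpow, mul_one, mul_comm, zpow_mul] at this
    exact this.symm
  refine ⟨r * u, ?_⟩
  change z ^ (r * u) = _
  rw [zpow_mul, ← h, conj_zpow, ← e]

theorem G_metacyclic (m : ℕ) (hm : 0 < m) (r s : ℤ) (hrs : IsCoprime r s) :
    IsMetacyclic (PresentedGroup (Erels m r s 1)) := by
  set x := eT m r s 1 with hx
  set z := eY m r s 1 with hz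
  have hrel : x * z ^ s * x⁻¹ = z ^ r := by simpa using eY_rel (n := m) (r := r) (s := s) (A := 1)
  have hxm : x ^ m = 1 := eT_pow
  have hD : z ^ (s ^ m - r ^ m) = 1 := by
    have := conj_pow_rel x z r s hrel m
    rw [hxm] at this
    rw [zpow_sub, ← this]; simp
  obtain ⟨k, hk⟩ : ∃ k, m = k + 1 := ⟨m - 1, by omega⟩
  have hcs : IsCoprime s (s ^ m - r ^ m) := by
    have h1 : IsCoprime s (-(r ^ m)) := (hrs.symm.pow_right).neg_right
    have e : s ^ m - r ^ m = -(r ^ m) + s * s ^ k := by rw [hk]; ring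
    rw [e]
    exact h1.add_mul_left_right (s ^ k)
  have hcr : IsCoprime r (s ^ m - r ^ m) := by
    have h1 : IsCoprime r (s ^ m) := hrs.pow_right
    have e : s ^ m - r ^ m = s ^ m + r * (-(r ^ k)) := by rw [hk]; ring
    rw [e]
    exact h1.add_mul_left_right (-(r ^ k))
  have hrel' : x⁻¹ * z ^ r * (x⁻¹)⁻¹ = z ^ s := by rw [← hrel]; group
  have c1 := conj_mem_aux x z r s _ hrel hD hcs
  have c2 := conj_mem_aux x⁻¹ z s r _ hrel' hD hcr
  have hn : (Subgroup.zpowers z).Normal := by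
    rw [← Subgroup.normalizer_eq_top_iff]
    apply E_top
    · rw [Subgroup.mem_normalizer_iff]
      intro h
      constructor
      · rintro ⟨k, rfl⟩
        change x * z ^ k * x⁻¹ ∈ _
        rw [← conj_zpow]
        exact zpow_mem c1 k
      · rintro ⟨k, hk⟩
        have : h = (x⁻¹ * z * (x⁻¹)⁻¹) ^ k := by
          rw [conj_zpow]
          change z ^ k = x * h * x⁻¹ at hk
          rw [hk]; group
        rw [this]
        exact zpow_mem c2 k
    · exact Subgroup.le_normalizer (Subgroup.mem_zpowers z)
  refine ⟨Subgroup.zpowers z, hn, inferInstance, ?_⟩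
  change IsCyclic (PresentedGroup (Erels m r s 1) ⧸ Subgroup.zpowers z)
  refine ⟨⟨QuotientGroup.mk' _ x, fun q => ?_⟩⟩
  obtain ⟨g, rfl⟩ := QuotientGroup.mk'_surjective _ q
  have : (Subgroup.zpowers (QuotientGroup.mk' (Subgroup.zpowers z) x)).comap
      (QuotientGroup.mk' (Subgroup.zpowers z)) = ⊤ := by
    apply E_top
    · exact Subgroup.mem_zpowers _
    · rw [Subgroup.mem_comap]
      have : QuotientGroup.mk' (Subgroup.zpowers z) z = 1 :=
        (QuotientGroup.eq_one_iff z).2 (Subgroup.mem_zpowers z)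
      change QuotientGroup.mk' (Subgroup.zpowers z) z ∈ _
      rw [this]; exact one_mem _
  have hg : g ∈ (⊤ : Subgroup (PresentedGroup (Erels m r s 1))) := trivial
  rw [← this] at hg
  exact hg

theorem FM_of_retract {Q : Type} [Group Q] (hQ : FM Q)
    (ψ : PresentedGroup (Erels n r s A) →* Q) (F : Q →* PresentedGroup (Erels n r s A))
    (h1 : F (ψ (eT n r s A)) = eT n r s A) (h2 : F (ψ (eY n r s A)) = eY n r s A) :
    FM (PresentedGroup (Erels n r s A)) := by
  refine hQ.of_inj ψ ?_
  have : F.comp ψ = MonoidHom.id _ := by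
    apply PresentedGroup.ext
    intro b
    cases b with
    | true => exact h1
    | false => exact h2
  exact Function.LeftInverse.injective (g := F) fun g => DFunLike.congr_fun this g

theorem FM_E (n : ℕ) (hn : 0 < n) (r s A : ℤ) : FM (PresentedGroup (Erels n r s A)) := by
  have : NeZero n := ⟨hn.ne'⟩
  have hcyc : ∀ k : ℕ, FM (Multiplicative (ZMod k)) := fun k => (IsMetacyclic.of_cyclic _).fm
  set τ : Multiplicative (ZMod n) := Multiplicative.ofAdd 1 with hτ
  have hτo : orderOf τ = n := orderOf_gen n
  have hτn : τ ^ n = 1 := orderOf_dvd_iff_pow_eq_one.1 (dvd_of_eq hτo)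
  rcases Nat.eq_zero_or_pos (Int.gcd r s) with hd | hd
  · obtain ⟨rfl, rfl⟩ := Int.gcd_eq_zero_iff.1 hd
    obtain ⟨fT, hfT⟩ := exists_cyclic_hom n (eT n 0 0 A) eT_pow
    obtain ⟨fY, hfY⟩ := exists_cyclic_hom 0 (eY n 0 0 A) (pow_zero _)
    obtain ⟨Q, _, i₁, i₂, -, -, hQ, hU⟩ := exists_amalgam (1 : Multiplicative (ZMod n))
      (1 : Multiplicative (ZMod 0)) (by simp) (hcyc n) (hcyc 0)
    obtain ⟨F, hF1, hF2⟩ := hU _ fT fY (by simp)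
    obtain ⟨ψ, hψ1, hψ2⟩ := exists_E_hom (n := n) (r := 0) (s := 0) (A := A) (i₁ τ)
      (i₂ (Multiplicative.ofAdd 1)) (by rw [← map_pow, hτn, map_one]) (by simp)
    exact FM_of_retract hQ ψ F (by rw [hψ1, hF1, hfT]) (by rw [hψ2, hF2, hfY])
  · obtain ⟨r', s', hrs, hr, hs⟩ := Int.exists_gcd_one hd
    rw [← Int.isCoprime_iff_gcd_eq_one] at hrs
    generalize Int.gcd r s = d at hd hr hs
    subst hr hs
    obtain ⟨r, hr⟩ : ∃ r, r = r' * (d : ℤ) := ⟨_, rfl⟩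
    obtain ⟨s, hs⟩ : ∃ s, s = s' * (d : ℤ) := ⟨_, rfl⟩
    rw [← hr, ← hs]
    obtain ⟨fT, hfT⟩ := exists_cyclic_hom n (eT n r s A) eT_pow
    set m := orderOf (τ ^ A) with hm
    have hm0 : 0 < m := orderOf_pos _
    set x := eT m r' s' 1
    set z := eY m r' s' 1
    have hxo : orderOf x = m := by
      apply Nat.dvd_antisymm
      · exact orderOf_dvd_of_pow_eq_one eT_pow
      · obtain ⟨f, hf, -⟩ := exists_E_hom (n := m) (r := r') (s := s') (A := 1) (τ ^ A) 1
          (pow_orderOf_eq_one _) (by simp)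
        have h := orderOf_map_dvd f x
        rw [hf] at h
        exact h
    set N := orderOf z with hN
    set υ : Multiplicative (ZMod (d * N)) := Multiplicative.ofAdd 1 with hυ
    have hυo : orderOf υ = d * N := orderOf_gen _
    have hυd : orderOf (υ ^ d) = N := by
      rw [orderOf_pow' _ hd.ne', hυo, Nat.gcd_eq_right (Dvd.intro _ rfl), Nat.mul_div_cancel_left _ hd]
    obtain ⟨Q₁, _, j₁, j₂, hj₁, hj, hQ₁, hU₁⟩ := exists_amalgam z (υ ^ d) hυd.symm
      (G_metacyclic m hm0 r' s' hrs).fm (hcyc _)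
    obtain ⟨Q, _, i₁, i₂, -, hi, hQ, hU⟩ := exists_amalgam (τ ^ A) (j₁ x)
      (by rw [orderOf_injective j₁ hj₁, hxo]) (hcyc n) hQ₁
    -- maps back to E
    obtain ⟨fG, hfG1, hfG2⟩ := exists_E_hom (n := m) (r := r') (s := s') (A := 1)
      (eT n r s A ^ A) (eY n r s A ^ d) (by
        rw [← hfT, ← map_zpow, ← map_pow, hm, pow_orderOf_eq_one, map_one]) (by
        rw [zpow_one, ← zpow_natCast, ← zpow_mul, ← zpow_mul, mul_comm _ s', mul_comm _ r', ← hr, ← hs]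
        exact eY_rel)
    obtain ⟨fY, hfY⟩ := exists_cyclic_hom (d * N) (eY n r s A) (by
      rw [pow_mul, ← hfG2, ← map_pow, hN, pow_orderOf_eq_one, map_one])
    obtain ⟨F₁, hF₁1, hF₁2⟩ := hU₁ _ fG fY (by rw [hfG2, map_pow, hfY])
    obtain ⟨F, hF1, hF2⟩ := hU _ fT F₁ (by rw [hF₁1, hfG1, map_zpow, hfT])
    have hzrel : x * z ^ s' * x⁻¹ = z ^ r' := by
      simpa using eY_rel (n := m) (r := r') (s := s') (A := 1)
    have hy : ∀ k : ℤ, (i₂ (j₂ υ)) ^ (k * (d : ℤ)) = i₂ (j₁ (z ^ k)) := by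
      intro k
      rw [map_zpow, map_zpow, hj, map_pow, map_pow, mul_comm k, zpow_mul, zpow_natCast]
    obtain ⟨ψ, hψ1, hψ2⟩ := exists_E_hom (n := n) (r := r) (s := s) (A := A) (i₁ τ)
      (i₂ (j₂ υ)) (by rw [← map_pow, hτn, map_one]) (by
        rw [hr, hs, hy, hy, ← map_zpow, hi, ← hzrel]
        simp only [map_mul, map_inv])
    exact FM_of_retract hQ ψ F (by rw [hψ1, hF1, hfT]) (by rw [hψ2, hF2, hF₁2, hfY])

end Main

/-- every finite subgroup of
`E = ⟨t,y | t^n, y^r t^A y^{-s} t^{-A}⟩` (`n > 0`) is metacyclic. -/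
theorem stmt_15 (n : ℕ) (hn : 0 < n) (r s A : ℤ)
    (H : Subgroup (PresentedGroup (Erels n r s A))) (hH : Finite H) :
    IsMetacyclic H := by
  exact FM_E n hn r s A H hH
end
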